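/- The polynomial Q(t) = t^20 + (1/3)t^18 + (2/3)t^17 - (1/3)t^16 + t^15 + (2/3)t^13 + (2/3)t^12 - (1/3)t^11 + t^10 - (1/3)t^9 + (2/3)t^8 + (2/3)t^7 + t^5 - (1/3)t^4 + (2/3)t^3 + (1/3)t^2 + 1 over Q has no root that is a root of unity. -/

import Mathlib

open Polynomial

/-- The trace polynomial of `3 * Q`: if `y = z + z⁻¹` then `3 * Q z = z ^ 10 * tracePoly y`. -/
noncomputable def tracePoly (y : ℂ) : ℂ :=
  3 * y ^ 10 - 29 * y ^ 8 + 2 * y ^ 7 + 96 * y ^ 6 - 11 * y ^ 5 - 124 * y ^ 4 + 15 * y ^ 3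
    + 52 * y ^ 2 - 6 * y - 3

theorem tracePoly_sq_sub_two_ne_zero {y : ℂ} (hy : tracePoly y = 0) : tracePoly (y ^ 2 - 2) ≠ 0 := by
  intro h
  unfold tracePoly at hy h
  have hone : (582349850 : ℂ) = 0 := by
    linear_combination
      (-137185641 * y ^ 19 - 61541412 * y ^ 18 + 2495327511 * y ^ 17 + 958377642 * y ^ 16
        - 19335067143 * y ^ 15 - 6064406501 * y ^ 14 + 83301616726 * y ^ 13
        + 19945303952 * y ^ 12 - 218062281171 * y ^ 11 - 36013924217 * y ^ 10
        + 354595600481 * y ^ 9 + 34129711187 * y ^ 8 - 348845289723 * y ^ 7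
        - 13804132481 * y ^ 6 + 189382406413 * y ^ 5 + 554031116 * y ^ 4
        - 44101890226 * y ^ 3 + 345515223 * y ^ 2 + 853414808 * y - 235198699) * hy
      + (137185641 * y ^ 9 + 61541412 * y ^ 8 - 1077742554 * y ^ 7 - 230992624 * y ^ 6
        + 2965395939 * y ^ 5 + 29076876 * y ^ 4 - 3320543291 * y ^ 3 + 393414803 * y ^ 2
        + 1149052230 * y - 123246247) * h
  norm_num at hone

theorem tracePoly_two_sub_sq_ne_zero {y : ℂ} (hy : tracePoly y = 0) : tracePoly (2 - y ^ 2) ≠ 0 := by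
  intro h
  unfold tracePoly at hy h
  have hone : (28304417710 : ℂ) = 0 := by
    linear_combination
      (2045144700 * y ^ 19 - 2955924456 * y ^ 18 - 40890996633 * y ^ 17
        + 57131458206 * y ^ 16 + 341700985689 * y ^ 15 - 460822504844 * y ^ 14
        - 1553511682195 * y ^ 13 + 2012895006688 * y ^ 12 + 4197420985524 * y ^ 11
        - 5160640390110 * y ^ 10 - 6935741576463 * y ^ 9 + 7845216071401 * y ^ 8
        + 6988836195324 * y ^ 7 - 6761928671554 * y ^ 6 - 4162385085155 * y ^ 5
        + 2923396754737 * y ^ 4 + 1329255585031 * y ^ 3 - 468599078881 * y ^ 2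
        - 160272741135 * y + 16258801080) * hy
      + (-2045144700 * y ^ 9 + 2955924456 * y ^ 8 + 19757834733 * y ^ 7 - 27950335294 * y ^ 6
        - 56941625344 * y ^ 5 + 79943206864 * y ^ 4 + 48102737301 * y ^ 3
        - 63644434673 * y ^ 2 - 15330616677 * y + 3083232838) * h
  norm_num at hone

theorem tracePoly_neg_ne_zero {y : ℂ} (hy : tracePoly y = 0) : tracePoly (-y) ≠ 0 := by
  intro h
  unfold tracePoly at hy h
  have hone : (990 : ℂ) = 0 := by
    linear_combination
      (318 * y ^ 9 - 2606 * y ^ 7 - 212 * y ^ 6 + 6705 * y ^ 5 + 854 * y ^ 4 - 4864 * y ^ 3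
        - 576 * y ^ 2 - 1142 * y - 165) * hy
      + (-318 * y ^ 9 + 2606 * y ^ 7 - 212 * y ^ 6 - 6705 * y ^ 5 + 854 * y ^ 4 + 4864 * y ^ 3
        - 576 * y ^ 2 + 1142 * y - 165) * h
  norm_num at hone

/-- A rational polynomial vanishing at a primitive root of unity vanishes at its conjugates. -/
theorem IsPrimitiveRoot.aeval_pow_eq_zero_of_coprime {n k : ℕ} {z : ℂ} (hz : IsPrimitiveRoot z n)
    (hn : 0 < n) (hk : k.Coprime n) {q : ℚ[X]} (hq : aeval z q = 0) : aeval (z ^ k) q = 0 := by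
  have hdvd : minpoly ℚ (z ^ k) ∣ q := by
    rw [← cyclotomic_eq_minpoly_rat (hz.pow_of_coprime k hk) hn, cyclotomic_eq_minpoly_rat hz hn]
    exact minpoly.dvd ℚ z hq
  exact aeval_eq_zero_of_dvd_aeval_eq_zero hdvd (minpoly.aeval ℚ (z ^ k))

/-- The degree-20 rational polynomial Q has no root of unity among its complex roots. -/
theorem no_root_of_unity
    (Q : Polynomial ℚ)
    (hQ : Q = X ^ 20 + C (1/3) * X ^ 18 + C (2/3) * X ^ 17 - C (1/3) * X ^ 16 + X ^ 15
        + C (2/3) * X ^ 13 + C (2/3) * X ^ 12 - C (1/3) * X ^ 11 + X ^ 10 - C (1/3) * X ^ 9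
        + C (2/3) * X ^ 8 + C (2/3) * X ^ 7 + X ^ 5 - C (1/3) * X ^ 4 + C (2/3) * X ^ 3
        + C (1/3) * X ^ 2 + 1) :
    ∀ z : ℂ, (∃ n : ℕ, 0 < n ∧ z ^ n = 1) → Polynomial.aeval z Q ≠ 0 := by
  rintro z ⟨m, hm, hzm⟩ hz
  have hroot : ∀ w y : ℂ, w ≠ 0 → y = w + w⁻¹ → aeval w Q = 0 → tracePoly y = 0 := by
    rintro w y hw rfl h
    have h3 : w ^ 10 * tracePoly (w + w⁻¹) = 3 * aeval w Q := by
      simp only [hQ, tracePoly, map_add, map_sub, map_mul, map_pow, aeval_X, aeval_C, map_one,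
        eq_ratCast]
      push_cast
      field_simp
      ring
    rw [h, mul_zero] at h3
    exact (mul_eq_zero.mp h3).resolve_left (pow_ne_zero _ hw)
  have hz0 : z ≠ 0 := by
    rintro rfl
    simp [hm.ne'] at hzm
  have hn : 0 < orderOf z := orderOf_pos_iff.mpr (isOfFinOrder_iff_pow_eq_one.mpr ⟨m, hm, hzm⟩)
  have hprim := IsPrimitiveRoot.orderOf z
  generalize orderOf z = n at hn hprim
  have hy := hroot z _ hz0 rfl hz
  rcases Nat.even_or_odd' n with ⟨l, rfl | rfl⟩
  · have hl : z ^ l = -1 := by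
      refine (sq_eq_one_iff.mp ?_).resolve_left (hprim.pow_ne_one_of_pos_of_lt (by lia) (by lia))
      rw [← pow_mul, mul_comm, hprim.pow_eq_one]
    rcases Nat.even_or_odd l with hl2 | hl2
    · have hk : (l + 1).Coprime (2 * l) := by
        refine Nat.Coprime.mul_right ?_ (by simp)
        exact (Nat.coprime_two_right).mpr hl2.add_one
      have h := hprim.aeval_pow_eq_zero_of_coprime hn hk hz
      rw [pow_succ, hl, neg_one_mul] at h
      refine tracePoly_neg_ne_zero hy (hroot (-z) _ (neg_ne_zero.mpr hz0) ?_ h)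
      rw [inv_neg]
      ring
    · have hk : (l + 2).Coprime (2 * l) := by
        refine Nat.Coprime.mul_right ?_ ?_
        · exact (Nat.coprime_two_right).mpr (hl2.add_even even_two)
        · simpa using hl2
      have h := hprim.aeval_pow_eq_zero_of_coprime hn hk hz
      rw [pow_add, hl, neg_one_mul] at h
      refine tracePoly_two_sub_sq_ne_zero hy (hroot (-z ^ 2) _ (by simpa using hz0) ?_ h)
      field_simp
      ring
  · have hk : Nat.Coprime 2 (2 * l + 1) := by simp
    have h := hprim.aeval_pow_eq_zero_of_coprime hn hk hz
    refine tracePoly_sq_sub_two_ne_zero hy (hroot (z ^ 2) _ (pow_ne_zero _ hz0) ?_ h)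
    field_simp
    ring
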